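/- Let p ≥ 2, α = p−1 and θ ≥ 0. The function s ↦ TMSC(s,α,θ) is continuous on the interval (0, μ_{α,θ}). -/

import Mathlib

open MeasureTheory Real Filter ENNReal

/-- The fractional-dimension spherical volume constant `ω_θ = 2π^((θ+1)/2)/Γ((θ+1)/2)`. -/
noncomputable def omegaW (θ : ℝ) : ℝ := 2 * Real.pi ^ ((θ + 1) / 2) / Real.Gamma ((θ + 1) / 2)

/-- Weighted integral `∫₀^∞ f dλ_θ = ω_θ ∫₀^∞ f(r) r^θ dr` (for nonnegative integrands,
valued in `ℝ≥0∞`). -/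
noncomputable def wInt (θ : ℝ) (f : ℝ → ℝ) : ℝ≥0∞ :=
  ENNReal.ofReal (omegaW θ) *
    ∫⁻ r in Set.Ioi (0 : ℝ), ENNReal.ofReal (f r) * ENNReal.ofReal (r ^ θ)

/-- The weighted Lebesgue norm `‖u‖_{L^q_θ}` (valued in `ℝ≥0∞`). -/
noncomputable def wNorm (θ q : ℝ) (u : ℝ → ℝ) : ℝ≥0∞ :=
  (wInt θ fun r => |u r| ^ q) ^ (1 / q)

/-- Membership in the weighted Sobolev space `X = X^{1,p}_∞(α,θ)`:
`u` is locally absolutely continuous on `(0,∞)` with a.e. derivative `u'`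
(expressed through the fundamental theorem of calculus on compact subintervals),
`u(r) → 0` as `r → ∞`, `‖u‖_{L^p_θ} < ∞` and `‖u'‖_{L^p_α} < ∞`. -/
structure MemX (p α θ : ℝ) (u u' : ℝ → ℝ) : Prop where
  ftc_int : ∀ a b : ℝ, 0 < a → a ≤ b → IntervalIntegrable u' MeasureTheory.volume a b
  ftc : ∀ a b : ℝ, 0 < a → a ≤ b → u b - u a = ∫ t in a..b, u' t
  lim_zero : Filter.Tendsto u Filter.atTop (nhds 0)
  fin_u : wNorm θ p u < ⊤
  fin_u' : wNorm α p u' < ⊤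

/-- Full norm on `X`: `‖u‖ = (‖u‖_{L^p_θ}^p + ‖u'‖_{L^p_α}^p)^{1/p}`. -/
noncomputable def Xnorm (p α θ : ℝ) (u u' : ℝ → ℝ) : ℝ≥0∞ :=
  ((wNorm θ p u) ^ p + (wNorm α p u') ^ p) ^ (1 / p)

/-- The truncated exponential `φ_p(t) = Σ_{j ∈ ℕ, j ≥ p-1} t^j / j!`. -/
noncomputable def phiP (p t : ℝ) : ℝ :=
  ∑' j : ℕ, if p - 1 ≤ (j : ℝ) then t ^ j / (Nat.factorial j : ℝ) else 0

/-- The critical constant `μ_{α,θ} = (θ+1) ω_α^{1/α}`. -/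
noncomputable def muC (α θ : ℝ) : ℝ := (θ + 1) * (omegaW α) ^ (1 / α)

/-- The Trudinger–Moser functional `∫₀^∞ φ_p(μ |u|^{p/(p-1)}) dλ_θ`. -/
noncomputable def TMfunc (p θ μ : ℝ) (u : ℝ → ℝ) : ℝ≥0∞ :=
  wInt θ fun r => phiP p (μ * |u r| ^ (p / (p - 1)))

/-- The subcritical Trudinger–Moser supremum
`TMSC(μ,α,θ) = sup { ‖u‖_{L^p_θ}^{-p} ∫₀^∞ φ_p(μ|u|^{p/(p-1)}) dλ_θ : u ∈ X, u ≠ 0, ‖u'‖_{L^p_α} ≤ 1 }`. -/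
noncomputable def TMSC (p α θ μ : ℝ) : ℝ≥0∞ :=
  ⨆ (u : ℝ → ℝ) (u' : ℝ → ℝ) (_ : MemX p α θ u u') (_ : u ≠ 0)
    (_ : wNorm α p u' ≤ 1), (wNorm θ p u) ^ (-p) * TMfunc p θ μ u

/-- The critical Trudinger–Moser supremum
`TMC(σ,α,θ) = sup { ∫₀^∞ φ_p(σ|u|^{p/(p-1)}) dλ_θ : u ∈ X, ‖u‖ ≤ 1 }`. -/
noncomputable def TMC (p α θ σ : ℝ) : ℝ≥0∞ :=
  ⨆ (u : ℝ → ℝ) (u' : ℝ → ℝ) (_ : MemX p α θ u u') (_ : Xnorm p α θ u u' ≤ 1),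
    TMfunc p θ σ u

/-- `k₀ = min { j ∈ ℕ : j ≥ p - 1 }`. -/
noncomputable def k0 (p : ℝ) : ℕ := sInf {j : ℕ | p - 1 ≤ (j : ℝ)}

/-- `TMC(σ,α,θ)` is attained by some `u ∈ X` with `‖u‖ ≤ 1`. -/
def TMCAttained (p α θ σ : ℝ) : Prop :=
  ∃ u u' : ℝ → ℝ, MemX p α θ u u' ∧ Xnorm p α θ u u' ≤ 1 ∧
    TMC p α θ σ = TMfunc p θ σ u

/-- `σ_* = inf { σ ∈ (0, μ_{α,θ}) : TMC(σ,α,θ) is attained }`. -/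
noncomputable def sigmaStar (p α θ : ℝ) : ℝ :=
  sInf {σ : ℝ | σ ∈ Set.Ioo 0 (muC α θ) ∧ TMCAttained p α θ σ}

lemma omegaW_pos {θ : ℝ} (hθ : 0 ≤ θ) : 0 < omegaW θ := by
  unfold omegaW
  have := Real.Gamma_pos_of_pos (show 0 < (θ + 1) / 2 by linarith)
  positivity

lemma summable_phiP (p t : ℝ) :
    Summable fun j : ℕ => if p - 1 ≤ (j : ℝ) then t ^ j / (Nat.factorial j : ℝ) else 0 := by
  refine .of_norm_bounded (Real.summable_pow_div_factorial t).norm fun j => ?_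
  split_ifs
  · rfl
  · simpa using norm_nonneg (t ^ j / (j.factorial : ℝ))

lemma phiP_nonneg (p : ℝ) {t : ℝ} (ht : 0 ≤ t) : 0 ≤ phiP p t := by
  refine tsum_nonneg fun j => ?_
  split_ifs <;> positivity

lemma phiP_le_exp (p : ℝ) {t : ℝ} (ht : 0 ≤ t) : phiP p t ≤ Real.exp t := by
  rw [Real.exp_eq_exp_ℝ, NormedSpace.exp_eq_tsum_div]
  refine (summable_phiP p t).tsum_le_tsum (fun j => ?_) (Real.summable_pow_div_factorial t)
  split_ifs
  · rfl
  · positivity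

lemma continuous_phiP (p : ℝ) : Continuous (phiP p) := by
  have h : phiP p = fun t => Real.exp t - ∑ j ∈ Finset.range ⌈p - 1⌉₊, t ^ j / (j.factorial : ℝ) := by
    funext t
    rw [Real.exp_eq_exp_ℝ, NormedSpace.exp_eq_tsum_div, eq_sub_iff_add_eq]
    have hs : HasSum (fun j : ℕ => if j ∈ Finset.range ⌈p - 1⌉₊ then t ^ j / (j.factorial : ℝ) else 0)
        (∑ j ∈ Finset.range ⌈p - 1⌉₊, t ^ j / (j.factorial : ℝ)) := by
      have h0 := hasSum_sum_of_ne_finset_zero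
        (f := fun j : ℕ => if j ∈ Finset.range ⌈p - 1⌉₊ then t ^ j / (j.factorial : ℝ) else 0)
        (s := Finset.range ⌈p - 1⌉₊) (L := SummationFilter.unconditional ℕ)
        fun j hj => if_neg hj
      rwa [Finset.sum_congr rfl fun j hj => if_pos hj] at h0
    refine ((summable_phiP p t).hasSum.add hs).tsum_eq.symm.trans (tsum_congr fun j => ?_)
    by_cases hj : p - 1 ≤ (j : ℝ)
    · have : ¬ j < ⌈p - 1⌉₊ := by rw [not_lt, Nat.ceil_le]; exact hj
      simp only [hj, this, Finset.mem_range, if_true, if_false, add_zero]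
    · have : j < ⌈p - 1⌉₊ := by rw [Nat.lt_ceil]; exact not_le.1 hj
      simp only [hj, this, Finset.mem_range, if_true, if_false, zero_add]
  rw [h]
  fun_prop

lemma convexOn_phiP (p : ℝ) : ConvexOn ℝ (Set.Ici 0) (phiP p) := by
  refine ⟨convex_Ici 0, fun x hx y hy a b ha hb hab => ?_⟩
  simp only [phiP, smul_eq_mul, ← tsum_mul_left]
  rw [← ((summable_phiP p x).mul_left a).tsum_add ((summable_phiP p y).mul_left b)]
  refine (summable_phiP p _).tsum_le_tsum (fun j => ?_)
    (((summable_phiP p x).mul_left a).add ((summable_phiP p y).mul_left b))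
  split_ifs
  · have := (convexOn_pow j).2 hx hy ha hb hab
    simp only [smul_eq_mul] at this
    rw [← mul_div_assoc, ← mul_div_assoc, ← add_div]
    gcongr
  · simp

/-- For small arguments the truncated exponential is controlled by its lowest-order power. -/
lemma phiP_mul_rpow_le {p s v : ℝ} (hp : 2 ≤ p) (hs : 0 ≤ s) (hv : 0 ≤ v) (hv1 : v ≤ 1) :
    phiP p (s * v ^ (p / (p - 1))) ≤ Real.exp s * v ^ p := by
  rw [Real.exp_eq_exp_ℝ, NormedSpace.exp_eq_tsum_div, ← tsum_mul_right]
  refine (summable_phiP p _).tsum_le_tsum (fun j => ?_)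
    ((Real.summable_pow_div_factorial s).mul_right _)
  split_ifs with hj
  · rw [mul_pow, mul_div_right_comm]
    gcongr
    rw [← Real.rpow_natCast, ← Real.rpow_mul hv]
    have hpj : p ≤ p / (p - 1) * j := by
      rw [div_mul_eq_mul_div, le_div_iff₀ (by linarith)]
      gcongr
    exact Real.rpow_le_rpow_of_exponent_ge_of_imp hv hv1 hpj (fun _ h => by linarith)
  · positivity

lemma MemX.continuousOn {p α θ : ℝ} {u u' : ℝ → ℝ} (h : MemX p α θ u u') :
    ContinuousOn u (Set.Ioi 0) := by
  intro x hx
  rw [Set.mem_Ioi] at hx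
  have hc : ContinuousOn (fun y => u (x / 2) + ∫ t in (x / 2)..y, u' t) (Set.Icc (x / 2) (x + 1)) := by
    refine continuousOn_const.add ?_
    have := intervalIntegral.continuousOn_primitive_interval'
      (h.ftc_int (x / 2) (x + 1) (by linarith) (by linarith)) Set.left_mem_uIcc
    rwa [Set.uIcc_of_le (by linarith)] at this
  refine ContinuousAt.continuousWithinAt ?_
  have hn : Set.Icc (x / 2) (x + 1) ∈ nhds x := Icc_mem_nhds (by linarith) (by linarith)
  refine (hc.continuousAt hn).congr ?_
  filter_upwards [hn] with y hy
  rw [← h.ftc (x / 2) y (by linarith) hy.1]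
  ring

lemma MemX.abs_sub_le {p α θ : ℝ} {u u' : ℝ → ℝ} (hp : 2 ≤ p) (hα : α = p - 1)
    (h : MemX p α θ u u') (h1 : wNorm α p u' ≤ 1) {r b : ℝ} (hr : 0 < r) (hrb : r ≤ b) :
    |u b - u r| ≤ (omegaW α)⁻¹ ^ (1 / p) * Real.log (b / r) ^ ((p - 1) / p) := by
  have hω := omegaW_pos (show 0 ≤ α by linarith)
  have hpq : p.HolderConjugate (p / (p - 1)) := Real.HolderConjugate.conjExponent (by linarith)
  have hint := h.ftc_int r b hr hrb
  have hlog : 0 ≤ Real.log (b / r) := Real.log_nonneg (by rw [le_div_iff₀ hr]; linarith)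
  rw [← ENNReal.ofReal_le_ofReal_iff (by positivity), ENNReal.ofReal_mul (by positivity),
    ← ENNReal.ofReal_rpow_of_nonneg (by positivity) (by positivity),
    ← ENNReal.ofReal_rpow_of_nonneg hlog (div_nonneg (by linarith) (by linarith))]
  have hmeas : AEMeasurable (fun t => ENNReal.ofReal |u' t| * ENNReal.ofReal (t ^ ((p - 1) / p)))
      (volume.restrict (Set.Ioc r b)) := by
    have := hint.1.aestronglyMeasurable.aemeasurable
    fun_prop
  have hmeas' : AEMeasurable (fun t : ℝ => ENNReal.ofReal (t ^ (-((p - 1) / p))))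
      (volume.restrict (Set.Ioc r b)) := by fun_prop
  have hleft : ENNReal.ofReal |u b - u r| ≤ ∫⁻ t in Set.Ioc r b,
      ENNReal.ofReal |u' t| := by
    rw [h.ftc r b hr hrb, intervalIntegral.integral_of_le hrb]
    have := enorm_integral_le_lintegral_enorm (μ := volume.restrict (Set.Ioc r b)) u'
    simpa only [Real.enorm_eq_ofReal_abs] using this
  have hsplit : ∫⁻ t in Set.Ioc r b, ENNReal.ofReal |u' t| = ∫⁻ t in Set.Ioc r b,
      ((fun t => ENNReal.ofReal |u' t| * ENNReal.ofReal (t ^ ((p - 1) / p))) *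
        fun t : ℝ => ENNReal.ofReal (t ^ (-((p - 1) / p)))) t := by
    refine setLIntegral_congr_fun measurableSet_Ioc fun t ht => ?_
    have ht0 : 0 < t := hr.trans ht.1
    simp only [Pi.mul_apply]
    rw [mul_assoc, ← ENNReal.ofReal_mul (by positivity), ← Real.rpow_add ht0]
    simp
  rw [hsplit] at hleft
  refine (hleft.trans (ENNReal.lintegral_mul_le_Lp_mul_Lq _ hpq hmeas hmeas')).trans ?_
  rw [one_div_div]
  refine mul_le_mul' (ENNReal.rpow_le_rpow ?_ (by positivity))
    (ENNReal.rpow_le_rpow ?_ (div_nonneg (by linarith) (by linarith)))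
  · have h2 : ENNReal.ofReal (omegaW α) * ∫⁻ t in Set.Ioi (0 : ℝ),
        ENNReal.ofReal (|u' t| ^ p) * ENNReal.ofReal (t ^ α) ≤ 1 := by
      have := ENNReal.rpow_le_rpow h1 (show 0 ≤ p by linarith)
      rwa [wNorm, ← ENNReal.rpow_mul, one_div_mul_cancel (by linarith), ENNReal.rpow_one,
        ENNReal.one_rpow, wInt] at this
    have h3 : ∫⁻ t in Set.Ioc r b,
        (ENNReal.ofReal |u' t| * ENNReal.ofReal (t ^ ((p - 1) / p))) ^ p ≤
        ∫⁻ t in Set.Ioi (0 : ℝ), ENNReal.ofReal (|u' t| ^ p) * ENNReal.ofReal (t ^ α) := by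
      refine le_trans (le_of_eq ?_) (lintegral_mono_set
        (s := Set.Ioc r b) (Set.Ioc_subset_Ioi_self.trans (Set.Ioi_subset_Ioi hr.le)))
      refine setLIntegral_congr_fun measurableSet_Ioc fun t ht => ?_
      have ht0 : 0 < t := hr.trans ht.1
      rw [ENNReal.mul_rpow_of_nonneg _ _ (by linarith),
        ENNReal.ofReal_rpow_of_nonneg (abs_nonneg _) (by linarith),
        ENNReal.ofReal_rpow_of_nonneg (by positivity) (by linarith), ← Real.rpow_mul ht0.le,
        div_mul_cancel₀ _ (by linarith), hα]
    refine h3.trans ?_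
    rw [ENNReal.ofReal_inv_of_pos hω]
    rw [ENNReal.le_inv_iff_mul_le, mul_comm]
    exact h2
  · refine le_of_eq ?_
    have hc : ∀ t ∈ Set.Ioc r b, ENNReal.ofReal (t ^ (-((p - 1) / p))) ^ (p / (p - 1)) =
        ENNReal.ofReal t⁻¹ := by
      intro t ht
      have ht0 : 0 < t := hr.trans ht.1
      rw [ENNReal.ofReal_rpow_of_nonneg (by positivity) (div_nonneg (by linarith) (by linarith)),
        ← Real.rpow_mul ht0.le, ← Real.rpow_neg_one]
      congr 2
      have : p - 1 ≠ 0 := by linarith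
      field_simp
    rw [setLIntegral_congr_fun measurableSet_Ioc hc, ← ofReal_integral_eq_lintegral_ofReal,
      ← intervalIntegral.integral_of_le hrb, integral_inv_of_pos hr (hr.trans_le hrb)]
    · refine (intervalIntegral.intervalIntegrable_inv (fun x hx => ?_) continuousOn_id).1
      rw [Set.uIcc_of_le hrb] at hx
      exact (hr.trans_le hx.1).ne'
    · filter_upwards [ae_restrict_mem measurableSet_Ioc] with t ht
      exact inv_nonneg.2 (hr.trans ht.1).le

lemma MemX.exists_first_le_one {p α θ : ℝ} {u u' : ℝ → ℝ} (h : MemX p α θ u u') {r : ℝ}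
    (hr : 0 < r) : ∃ b, r ≤ b ∧ |u b| ≤ 1 ∧ ∀ t ∈ Set.Ico r b, 1 < |u t| := by
  set S := Set.Ici r ∩ (fun t => |u t|) ⁻¹' Set.Iic 1
  have hcl : IsClosed S :=
    ((h.continuousOn.mono fun t ht => hr.trans_le ht).abs).preimage_isClosed_of_isClosed
      isClosed_Ici isClosed_Iic
  have hne : S.Nonempty := by
    have h0 := h.lim_zero.abs
    rw [abs_zero] at h0
    obtain ⟨t, h1, h2⟩ := ((h0.eventually_le_const one_pos).and (eventually_ge_atTop r)).exists
    exact ⟨t, h2, h1⟩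
  have hbdd : BddBelow S := ⟨r, fun t ht => ht.1⟩
  have hm := hcl.csInf_mem hne hbdd
  refine ⟨sInf S, hm.1, hm.2, fun t ht => ?_⟩
  by_contra! hle
  exact absurd (csInf_le hbdd ⟨ht.1, hle⟩) (not_le.2 ht.2)

lemma one_add_rpow_le {q δ x : ℝ} (hq : 0 ≤ q) (hδ : 0 < δ) (hx : 0 ≤ x) :
    (1 + x) ^ q ≤ (1 + δ) ^ q * x ^ q + (1 + δ⁻¹) ^ q := by
  rcases le_total x δ⁻¹ with hxδ | hxδ
  · have : (1 + x) ^ q ≤ (1 + δ⁻¹) ^ q := by gcongr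
    have : 0 ≤ (1 + δ) ^ q * x ^ q := by positivity
    linarith
  · have h1 : 1 + x ≤ (1 + δ) * x := by
      have : 1 ≤ δ * x := by rwa [inv_le_iff_one_le_mul₀' hδ] at hxδ
      linarith
    have : (1 + x) ^ q ≤ ((1 + δ) * x) ^ q := by gcongr
    rw [Real.mul_rpow (by positivity) hx] at this
    have : 0 ≤ (1 + δ⁻¹) ^ q := by positivity
    linarith

lemma ofReal_rpow_eq_add_lintegral {γ r b : ℝ} (hγ : 0 < γ) (hr : 0 < r) (hrb : r ≤ b) :
    ENNReal.ofReal (b ^ γ) = ENNReal.ofReal (r ^ γ) +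
      ∫⁻ t in Set.Ioc r b, ENNReal.ofReal (γ * t ^ (γ - 1)) := by
  rw [← ofReal_integral_eq_lintegral_ofReal, ← intervalIntegral.integral_of_le hrb,
    intervalIntegral.integral_const_mul, integral_rpow (Or.inl (by linarith)), sub_add_cancel,
    mul_div_cancel₀ _ hγ.ne', ← ENNReal.ofReal_add (by positivity), add_sub_cancel]
  · rw [sub_nonneg]; gcongr
  · exact ((intervalIntegral.intervalIntegrable_rpow' (by linarith)).const_mul γ).1
  · filter_upwards [ae_restrict_mem measurableSet_Ioc] with t ht
    have := hr.trans ht.1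
    simp only [Pi.zero_apply]
    positivity

lemma lintegral_Ioo_rpow {a t : ℝ} (ha : -1 < a) (ht : 0 < t) :
    ∫⁻ r in Set.Ioo 0 t, ENNReal.ofReal (r ^ a) = ENNReal.ofReal (t ^ (a + 1) / (a + 1)) := by
  rw [setLIntegral_congr Ioo_ae_eq_Ioc, ← ofReal_integral_eq_lintegral_ofReal,
    ← intervalIntegral.integral_of_le ht.le,
    integral_rpow (Or.inl ha), Real.zero_rpow (by linarith), sub_zero]
  · exact (intervalIntegral.intervalIntegrable_rpow' ha).1
  · filter_upwards [ae_restrict_mem measurableSet_Ioc] with r hr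
    exact Real.rpow_nonneg hr.1.le a

/-- A Hardy-type inequality on an arbitrary measurable subset of the half-line. -/
lemma lintegral_rpow_mul_lintegral_Ioi_le {γ θ : ℝ} (hγ : 0 < γ) (hγθ : γ < θ + 1) {A : Set ℝ}
    (hA0 : A ⊆ Set.Ioi 0) :
    ∫⁻ r in A, ENNReal.ofReal (r ^ (θ - γ)) *
        ∫⁻ t in A, (Set.Ioi r).indicator (fun t => ENNReal.ofReal (γ * t ^ (γ - 1))) t ≤
      ENNReal.ofReal (γ / (θ + 1 - γ)) * ∫⁻ t in A, ENNReal.ofReal (t ^ θ) := by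
  have hjoint : Measurable (Function.uncurry fun r t : ℝ => ENNReal.ofReal (r ^ (θ - γ)) *
      (Set.Ioi r).indicator (fun t => ENNReal.ofReal (γ * t ^ (γ - 1))) t) := by
    refine Measurable.mul (by fun_prop) ?_
    have : (fun x : ℝ × ℝ => (Set.Ioi x.1).indicator
        (fun t => ENNReal.ofReal (γ * t ^ (γ - 1))) x.2) =
        {x : ℝ × ℝ | x.1 < x.2}.indicator (fun x => ENNReal.ofReal (γ * x.2 ^ (γ - 1))) := by
      funext x
      simp [Set.indicator_apply]
    rw [this]
    exact Measurable.indicator (by fun_prop) (measurableSet_lt measurable_fst measurable_snd)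
  have hin : ∀ r : ℝ, Measurable
      ((Set.Ioi r).indicator fun t : ℝ => ENNReal.ofReal (γ * t ^ (γ - 1))) := fun r =>
    Measurable.indicator (by fun_prop) measurableSet_Ioi
  simp_rw [← lintegral_const_mul _ (hin _)]
  rw [lintegral_lintegral_swap hjoint.aemeasurable,
    ← lintegral_const_mul _ (by fun_prop)]
  refine setLIntegral_mono (by fun_prop) fun t ht => ?_
  have ht0 : 0 < t := hA0 ht
  calc ∫⁻ r in A, ENNReal.ofReal (r ^ (θ - γ)) *
        (Set.Ioi r).indicator (fun t => ENNReal.ofReal (γ * t ^ (γ - 1))) t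
      ≤ ∫⁻ r in Set.Ioi 0, ENNReal.ofReal (r ^ (θ - γ)) *
        (Set.Ioi r).indicator (fun t => ENNReal.ofReal (γ * t ^ (γ - 1))) t :=
        lintegral_mono_set hA0
    _ = ∫⁻ r in Set.Ioi 0, (Set.Iio t).indicator
        (fun r => ENNReal.ofReal (r ^ (θ - γ)) * ENNReal.ofReal (γ * t ^ (γ - 1))) r := by
        congr 1 with r
        by_cases hrt : r < t <;> simp [hrt]
    _ = (∫⁻ r in Set.Ioo 0 t, ENNReal.ofReal (r ^ (θ - γ))) * ENNReal.ofReal (γ * t ^ (γ - 1)) := by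
        rw [setLIntegral_indicator measurableSet_Iio, Set.inter_comm, Set.Ioi_inter_Iio,
          lintegral_mul_const _ (by fun_prop)]
    _ = ENNReal.ofReal (γ / (θ + 1 - γ)) * ENNReal.ofReal (t ^ θ) := by
        rw [lintegral_Ioo_rpow (by linarith) ht0, ← ENNReal.ofReal_mul, ← ENNReal.ofReal_mul]
        · congr 1
          have h : t ^ θ = t ^ (θ - γ + 1) * t ^ (γ - 1) := by
            rw [← Real.rpow_add ht0]; congr 1; ring
          rw [h, show θ - γ + 1 = θ + 1 - γ by ring]
          ring
        · exact div_nonneg hγ.le (by linarith)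
        · exact div_nonneg (by positivity) (by linarith)

/-- Any exponent strictly below the critical one leaves room for a slightly enlarged rate. -/
lemma exists_rate_lt {p θ s ω : ℝ} (hω : 0 < ω)
    (hs : s < (θ + 1) * ω ^ (1 / (p - 1))) :
    ∃ δ > 0, s * (1 + δ) ^ (p / (p - 1)) * ω⁻¹ ^ (1 / (p - 1)) < θ + 1 := by
  have hlim : Tendsto (fun δ : ℝ => s * (1 + δ) ^ (p / (p - 1)) * ω⁻¹ ^ (1 / (p - 1)))
      (nhdsWithin 0 (Set.Ioi 0)) (nhds (s * (1 + 0) ^ (p / (p - 1)) * ω⁻¹ ^ (1 / (p - 1)))) := by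
    refine tendsto_nhdsWithin_of_tendsto_nhds (ContinuousAt.tendsto ?_)
    refine (continuousAt_const.mul (ContinuousAt.rpow_const (by fun_prop) (Or.inl ?_))).mul
      continuousAt_const
    norm_num
  have hlt : s * (1 + 0) ^ (p / (p - 1)) * ω⁻¹ ^ (1 / (p - 1)) < θ + 1 := by
    rw [add_zero, Real.one_rpow, mul_one, Real.inv_rpow hω.le, ← div_eq_mul_inv,
      div_lt_iff₀ (by positivity)]
    exact hs
  obtain ⟨δ, h1, h2⟩ := ((hlim.eventually_lt_const hlt).and self_mem_nhdsWithin).exists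
  exact ⟨δ, h2, h1⟩

lemma MemX.exp_le {p α θ : ℝ} {u u' : ℝ → ℝ} (hp : 2 ≤ p) (hα : α = p - 1)
    (h : MemX p α θ u u') (h1 : wNorm α p u' ≤ 1) {s δ r b : ℝ} (hs : 0 ≤ s) (hδ : 0 < δ)
    (hr : 0 < r) (hrb : r ≤ b) (hb : |u b| ≤ 1) :
    Real.exp (s * |u r| ^ (p / (p - 1))) ≤ Real.exp (s * (1 + δ⁻¹) ^ (p / (p - 1))) *
      (b / r) ^ (s * (1 + δ) ^ (p / (p - 1)) * (omegaW α)⁻¹ ^ (1 / (p - 1))) := by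
  have hω := omegaW_pos (show 0 ≤ α by linarith)
  have hlog : 0 ≤ Real.log (b / r) := Real.log_nonneg (by rw [le_div_iff₀ hr]; linarith)
  have hp1 : p - 1 ≠ 0 := by linarith
  have hp0 : p ≠ 0 := by linarith
  have hq : 0 ≤ p / (p - 1) := div_nonneg (by linarith) (by linarith)
  set x := (omegaW α)⁻¹ ^ (1 / p) * Real.log (b / r) ^ ((p - 1) / p) with hx
  have hx0 : 0 ≤ x := by positivity
  have hxq : x ^ (p / (p - 1)) = (omegaW α)⁻¹ ^ (1 / (p - 1)) * Real.log (b / r) := by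
    rw [hx, Real.mul_rpow (by positivity) (by positivity), ← Real.rpow_mul (by positivity),
      ← Real.rpow_mul hlog]
    have e1 : 1 / p * (p / (p - 1)) = 1 / (p - 1) := by field_simp
    have e2 : (p - 1) / p * (p / (p - 1)) = 1 := by field_simp
    rw [e1, e2, Real.rpow_one]
  have hux : |u r| ≤ 1 + x := by
    have := h.abs_sub_le hp hα h1 hr hrb
    have h2 := abs_sub_abs_le_abs_sub (u r) (u b)
    rw [abs_sub_comm] at h2
    linarith
  have h3 : |u r| ^ (p / (p - 1)) ≤ (1 + x) ^ (p / (p - 1)) := by gcongr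
  have h4 := h3.trans (one_add_rpow_le hq hδ hx0)
  rw [hxq] at h4
  rw [Real.rpow_def_of_pos (div_pos (hr.trans_le hrb) hr), ← Real.exp_add]
  refine Real.exp_le_exp.2 ((mul_le_mul_of_nonneg_left h4 hs).trans (le_of_eq ?_))
  ring

/-- A uniform bound for the Trudinger–Moser functional by the `L^p_θ` norm. -/
lemma exists_TMfunc_le {p α θ : ℝ} (hp : 2 ≤ p) (hα : α = p - 1) {s : ℝ}
    (hs : s ∈ Set.Ioo 0 (muC α θ)) :
    ∃ C : ℝ≥0∞, C < ⊤ ∧ ∀ u u' : ℝ → ℝ, MemX p α θ u u' → wNorm α p u' ≤ 1 →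
      TMfunc p θ s u ≤ C * wInt θ fun r => |u r| ^ p := by
  have hω := omegaW_pos (show 0 ≤ α by linarith)
  obtain ⟨hs0, hs1⟩ := hs
  rw [muC] at hs1
  obtain ⟨δ, hδ, hγ1⟩ := exists_rate_lt (p := p) hω (by rwa [← hα])
  set γ := s * (1 + δ) ^ (p / (p - 1)) * (omegaW α)⁻¹ ^ (1 / (p - 1)) with hγdef
  have hγ0 : 0 < γ := by positivity
  set M := ENNReal.ofReal (Real.exp (s * (1 + δ⁻¹) ^ (p / (p - 1)))) with hM
  refine ⟨ENNReal.ofReal (Real.exp s) + M * (1 + ENNReal.ofReal (γ / (θ + 1 - γ))), ?_,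
    fun u u' hu hu1 => ?_⟩
  · finiteness
  have hcont := hu.continuousOn
  set A := Set.Ioi (0 : ℝ) ∩ u ⁻¹' {y | 1 < |y|} with hAdef
  have hAo : IsOpen A := hcont.isOpen_inter_preimage isOpen_Ioi
    (isOpen_lt continuous_const continuous_abs)
  have hA0 : A ⊆ Set.Ioi 0 := Set.inter_subset_left
  set W : ℝ → ℝ≥0∞ := fun r => ENNReal.ofReal (|u r| ^ p) * ENNReal.ofReal (r ^ θ) with hW
  set G : ℝ → ℝ≥0∞ := fun r => ENNReal.ofReal (r ^ θ) + ENNReal.ofReal (r ^ (θ - γ)) *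
    ∫⁻ t in A, (Set.Ioi r).indicator (fun t => ENNReal.ofReal (γ * t ^ (γ - 1))) t with hG
  have hum : AEMeasurable u (volume.restrict (Set.Ioi 0)) :=
    hcont.aemeasurable measurableSet_Ioi
  have hWm : AEMeasurable W (volume.restrict (Set.Ioi 0)) := by fun_prop
  have hexp_eq : ∀ r ∈ Set.Ioi (0 : ℝ), ∀ b, r ≤ b →
      ENNReal.ofReal ((b / r) ^ γ) * ENNReal.ofReal (r ^ θ) = ENNReal.ofReal (r ^ θ) +
        ENNReal.ofReal (r ^ (θ - γ)) *
          ∫⁻ t in Set.Ioc r b, ENNReal.ofReal (γ * t ^ (γ - 1)) := by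
    intro r hr b hb
    rw [Set.mem_Ioi] at hr
    have hb0 := hr.trans_le hb
    have e1 : ENNReal.ofReal ((b / r) ^ γ) * ENNReal.ofReal (r ^ θ) =
        ENNReal.ofReal (r ^ (θ - γ)) * ENNReal.ofReal (b ^ γ) := by
      rw [← ENNReal.ofReal_mul (by positivity), ← ENNReal.ofReal_mul (by positivity),
        Real.div_rpow hb0.le hr.le, Real.rpow_sub hr]
      congr 1
      ring
    rw [e1, ofReal_rpow_eq_add_lintegral hγ0 hr hb, mul_add,
      ← ENNReal.ofReal_mul (by positivity), ← Real.rpow_add hr, sub_add_cancel]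
  have hpt : ∀ r ∈ Set.Ioi (0 : ℝ), ENNReal.ofReal (phiP p (s * |u r| ^ (p / (p - 1)))) *
      ENNReal.ofReal (r ^ θ) ≤ ENNReal.ofReal (Real.exp s) * W r + M * A.indicator G r := by
    intro r hr
    by_cases hrA : r ∈ A
    · rw [Set.indicator_of_mem hrA]
      refine le_add_left ?_
      obtain ⟨b, hrb, hb1, hb2⟩ := hu.exists_first_le_one hr
      have hφ := (phiP_le_exp p (t := s * |u r| ^ (p / (p - 1))) (by positivity)).trans
        (hu.exp_le hp hα hu1 hs0.le hδ hr hrb hb1)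
      calc _ ≤ M * ENNReal.ofReal ((b / r) ^ γ) * ENNReal.ofReal (r ^ θ) := by
            gcongr
            rw [hM, ← ENNReal.ofReal_mul (by positivity)]
            exact ENNReal.ofReal_le_ofReal hφ
        _ ≤ M * G r := by
            rw [mul_assoc, hexp_eq r hr b hrb]
            simp only [hG]
            refine mul_le_mul_right (add_le_add_right (mul_le_mul_right ?_ _) _) _
            rw [setLIntegral_indicator measurableSet_Ioi, ← setLIntegral_congr Ioo_ae_eq_Ioc]
            refine lintegral_mono_set fun t ht => ⟨ht.1, ?_, hb2 t ⟨ht.1.le, ht.2⟩⟩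
            exact lt_trans (Set.mem_Ioi.1 hr) ht.1
    · refine le_add_right ?_
      have hle : |u r| ≤ 1 := by
        by_contra! hlt
        exact hrA ⟨hr, hlt⟩
      simp only [hW]
      rw [← mul_assoc, ← ENNReal.ofReal_mul (p := Real.exp s) (by positivity)]
      gcongr
      exact phiP_mul_rpow_le hp hs0.le (abs_nonneg _) hle
  have hAint : ∫⁻ r in A, ENNReal.ofReal (r ^ θ) ≤ ∫⁻ r in Set.Ioi 0, W r := by
    refine le_trans (setLIntegral_mono_ae' hAo.measurableSet (.of_forall fun r hr => ?_))
      (lintegral_mono_set hA0)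
    have hr1 : 1 ≤ |u r| := le_of_lt hr.2
    refine le_mul_of_one_le_left zero_le ?_
    rw [ENNReal.one_le_ofReal]
    exact Real.one_le_rpow hr1 (by linarith)
  have hGint : ∫⁻ r in Set.Ioi 0, A.indicator G r ≤
      (1 + ENNReal.ofReal (γ / (θ + 1 - γ))) * ∫⁻ r in Set.Ioi 0, W r := by
    rw [setLIntegral_indicator hAo.measurableSet, Set.inter_eq_left.2 hA0, hG,
      lintegral_add_left (by fun_prop), add_mul, one_mul]
    gcongr
    exact (lintegral_rpow_mul_lintegral_Ioi_le hγ0 hγ1 hA0).trans (by gcongr)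
  rw [TMfunc, wInt, wInt, mul_left_comm]
  gcongr
  calc _ ≤ ∫⁻ r in Set.Ioi 0, (ENNReal.ofReal (Real.exp s) * W r + M * A.indicator G r) :=
        setLIntegral_mono_ae' measurableSet_Ioi (.of_forall hpt)
    _ = ENNReal.ofReal (Real.exp s) * (∫⁻ r in Set.Ioi 0, W r) +
        M * ∫⁻ r in Set.Ioi 0, A.indicator G r := by
        rw [lintegral_add_left' (hWm.const_mul _), lintegral_const_mul'' _ hWm,
          lintegral_const_mul' _ _ (by finiteness)]
    _ ≤ _ := by
        rw [add_mul, mul_assoc]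
        gcongr

/-- The subcritical Trudinger–Moser inequality. -/
lemma TMSC_lt_top {p α θ : ℝ} (hp : 2 ≤ p) (hα : α = p - 1) {s : ℝ}
    (hs : s ∈ Set.Ioo 0 (muC α θ)) : TMSC p α θ s < ⊤ := by
  obtain ⟨C, hC, hbound⟩ := exists_TMfunc_le hp hα hs
  refine lt_of_le_of_lt ?_ hC
  refine iSup_le fun u => iSup_le fun u' => iSup_le fun hu => iSup_le fun _ => iSup_le fun hu1 => ?_
  have hN : wNorm θ p u ^ (-p) = (wInt θ fun r => |u r| ^ p)⁻¹ := by
    rw [wNorm, ← ENNReal.rpow_mul, mul_neg, one_div_mul_cancel (by linarith), ENNReal.rpow_neg_one]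
  rw [hN]
  refine (mul_le_mul_right (hbound u u' hu hu1) _).trans ?_
  rw [mul_left_comm]
  exact mul_le_of_le_one_right' (ENNReal.inv_mul_le_one _)

lemma MemX.TMfunc_add_le {p α θ : ℝ} {u u' : ℝ → ℝ} (hu : MemX p α θ u u') {x y a b : ℝ}
    (hx : 0 ≤ x) (hy : 0 ≤ y) (ha : 0 ≤ a) (hb : 0 ≤ b) (hab : a + b = 1) :
    TMfunc p θ (a * x + b * y) u ≤
      ENNReal.ofReal a * TMfunc p θ x u + ENNReal.ofReal b * TMfunc p θ y u := by
  have hum : AEMeasurable u (volume.restrict (Set.Ioi 0)) :=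
    hu.continuousOn.aemeasurable measurableSet_Ioi
  have hφ := (continuous_phiP p).measurable
  simp only [TMfunc, wInt]
  rw [mul_left_comm, mul_left_comm (ENNReal.ofReal b), ← mul_add,
    ← lintegral_const_mul' (ENNReal.ofReal a) _ ENNReal.ofReal_ne_top,
    ← lintegral_const_mul' (ENNReal.ofReal b) _ ENNReal.ofReal_ne_top, ← lintegral_add_left' (by fun_prop)]
  gcongr with r
  rw [← mul_assoc, ← mul_assoc, ← add_mul]
  gcongr
  set v := |u r| ^ (p / (p - 1))
  have hv : 0 ≤ v := by positivity
  have hxv : 0 ≤ x * v := by positivity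
  have hyv : 0 ≤ y * v := by positivity
  have h := (convexOn_phiP p).2 (Set.mem_Ici.2 hxv) (Set.mem_Ici.2 hyv) ha hb hab
  simp only [smul_eq_mul] at h
  rw [← ENNReal.ofReal_mul ha, ← ENNReal.ofReal_mul hb, ← ENNReal.ofReal_add
    (mul_nonneg ha (phiP_nonneg p hxv)) (mul_nonneg hb (phiP_nonneg p hyv))]
  refine ENNReal.ofReal_le_ofReal (le_of_eq_of_le ?_ h)
  congr 1
  ring

lemma TMSC_add_le {p α θ x y a b : ℝ} (hx : 0 ≤ x) (hy : 0 ≤ y) (ha : 0 ≤ a) (hb : 0 ≤ b)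
    (hab : a + b = 1) :
    TMSC p α θ (a * x + b * y) ≤
      ENNReal.ofReal a * TMSC p α θ x + ENNReal.ofReal b * TMSC p α θ y := by
  refine iSup_le fun u => iSup_le fun u' => iSup_le fun hu => iSup_le fun hu0 => iSup_le fun hu1 => ?_
  have key : ∀ s, wNorm θ p u ^ (-p) * TMfunc p θ s u ≤ TMSC p α θ s := fun s =>
    le_iSup_of_le u <| le_iSup_of_le u' <| le_iSup_of_le hu <| le_iSup_of_le hu0 <|
      le_iSup_of_le hu1 le_rfl
  calc _ ≤ wNorm θ p u ^ (-p) * (ENNReal.ofReal a * TMfunc p θ x u +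
        ENNReal.ofReal b * TMfunc p θ y u) := by
        gcongr
        exact hu.TMfunc_add_le hx hy ha hb hab
    _ = ENNReal.ofReal a * (wNorm θ p u ^ (-p) * TMfunc p θ x u) +
        ENNReal.ofReal b * (wNorm θ p u ^ (-p) * TMfunc p θ y u) := by ring
    _ ≤ _ := by gcongr <;> exact key _

lemma convexOn_toReal_TMSC {p α θ : ℝ} (hp : 2 ≤ p) (hα : α = p - 1) :
    ConvexOn ℝ (Set.Ioo 0 (muC α θ)) fun s => (TMSC p α θ s).toReal := by
  refine ⟨convex_Ioo _ _, fun x hx y hy a b ha hb hab => ?_⟩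
  have hfx := (TMSC_lt_top hp hα hx).ne
  have hfy := (TMSC_lt_top hp hα hy).ne
  have h := ENNReal.toReal_mono (by finiteness)
    (TMSC_add_le (p := p) (α := α) (θ := θ) hx.1.le hy.1.le ha hb hab)
  rwa [ENNReal.toReal_add (by finiteness) (by finiteness), ENNReal.toReal_mul, ENNReal.toReal_mul,
    ENNReal.toReal_ofReal ha, ENNReal.toReal_ofReal hb] at h

theorem stmt_16 (p α θ : ℝ) (hp : 2 ≤ p) (hα : α = p - 1) (hθ : 0 ≤ θ) :
    ContinuousOn (fun s : ℝ => TMSC p α θ s) (Set.Ioo 0 (muC α θ)) := by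
  have hc := (convexOn_toReal_TMSC (θ := θ) hp hα).continuousOn isOpen_Ioo
  refine (ENNReal.continuous_ofReal.comp_continuousOn hc).congr fun s hs => ?_
  exact (ENNReal.ofReal_toReal (TMSC_lt_top hp hα hs).ne).symm
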